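/- If y, A ≥ 1 are real numbers with y ≤ A·(log₂ y)², then y ≤ 5A·log²(18A), where log is the natural logarithm. -/

import Mathlib

theorem sq_logb_two_le (y : ℝ) : Real.logb 2 y ^ 2 ≤ 2.1 * Real.log y ^ 2 := by
  have hl := Real.log_two_gt_d9
  rw [Real.logb, div_pow, div_le_iff₀ (by positivity)]
  have h2 : (1 : ℝ) ≤ 2.1 * Real.log 2 ^ 2 := by nlinarith
  nlinarith [mul_le_mul_of_nonneg_left h2 (sq_nonneg (Real.log y))]

theorem sq_div_five_le_exp_div_three {t : ℝ} (ht : 0 ≤ t) :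
    t ^ 2 / 5 ≤ Real.exp (t / 3) := by
  have he := Real.exp_one_gt_d9
  have h1 : t / 6 ≤ Real.exp (t / 6 - 1) := by
    linarith [Real.add_one_le_exp (t / 6 - 1)]
  have h2 : 2.7 * (t / 6) ≤ Real.exp (t / 6) := by
    have h3 : Real.exp (t / 6) = Real.exp 1 * Real.exp (t / 6 - 1) := by
      rw [← Real.exp_add]; ring_nf
    rw [h3]
    exact mul_le_mul (by linarith) h1 (by positivity) (by positivity)
  have h4 : Real.exp (t / 3) = Real.exp (t / 6) ^ 2 := by
    rw [← Real.exp_nat_mul]; push_cast; ring_nf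
  rw [h4]
  nlinarith [pow_le_pow_left₀ (by positivity) h2 2, sq_nonneg t]

theorem le_of_le_mul_logb_sq (y A : ℝ) (hy : 1 ≤ y) (hA : 1 ≤ A)
    (h : y ≤ A * (Real.logb 2 y) ^ 2) :
    y ≤ 5 * A * (Real.log (18 * A)) ^ 2 := by
  have hL : 0 < Real.log (18 * A) := Real.log_pos (by linarith)
  have ht : 0 ≤ Real.log y := Real.log_nonneg hy
  have hyA : y ≤ A * (2.1 * Real.log y ^ 2) :=
    h.trans (mul_le_mul_of_nonneg_left (sq_logb_two_le y) (by linarith))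
  have key : Real.log y ≤ 3 / 2 * Real.log (18 * A) := by
    by_contra! hlt
    have ht0 : 0 < Real.log y := by linarith
    have hA' : 18 * A ≤ Real.exp (Real.log y / 3) ^ 2 := by
      rw [← Real.exp_nat_mul, ← Real.log_le_iff_le_exp (by linarith)]
      push_cast
      linarith
    have hy3 : y = Real.exp (Real.log y / 3) ^ 3 := by
      rw [← Real.exp_nat_mul]
      push_cast
      rw [mul_div_cancel₀ _ (by norm_num), Real.exp_log (by linarith)]
    have hE := sq_div_five_le_exp_div_three ht
    have hpos := Real.exp_pos (Real.log y / 3)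
    set E := Real.exp (Real.log y / 3)
    set t := Real.log y
    have ht2 : 0 < t ^ 2 := by positivity
    have h1 : E ^ 2 * (t ^ 2 / 5) ≤ E ^ 3 := by
      nlinarith [mul_le_mul_of_nonneg_left hE (sq_nonneg E)]
    have h2 : 18 * A * t ^ 2 ≤ E ^ 2 * t ^ 2 := mul_le_mul_of_nonneg_right hA' ht2.le
    have h3 : 0 < A * t ^ 2 := by positivity
    linarith
  have hsq := mul_le_mul_of_nonneg_left (pow_le_pow_left₀ ht key 2) (by linarith : 0 ≤ A)
  have hAL : 0 ≤ A * Real.log (18 * A) ^ 2 := by positivity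
  nlinarith
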